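/- arXiv:2403.07561 — 4 statements merged into one kernel-verified Lean document; each statement's English description precedes it below -/
import Mathlib

section
/- Let G be a simple graph, k a natural number, and C a k-defective clique of G with |C| ≥ k+2. Then the induced structure on C has diameter at most two: for any two distinct vertices u, v ∈ C that are not adjacent in G, there exists a vertex w ∈ C with w ≠ u, w ≠ v such that w is adjacent to both u and v. -/
open Finset

/-- The number of non-edges (unordered pairs of distinct non-adjacent vertices) induced by a
finite vertex set `C` in a simple graph `G`. -/
def nonEdges {V : Type*} [DecidableEq V] (G : SimpleGraph V) [DecidableRel G.Adj]
    (C : Finset V) : ℕ :=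
  ((C ×ˢ C).filter (fun p => p.1 ≠ p.2 ∧ ¬ G.Adj p.1 p.2)).card / 2

/-- If every vertex of `C` other than `u` is sent by `p` to a distinct non-neighbour in `C`, and no
two of these vertices are sent to each other, then `C` induces at least `|C| - 1` non-edges. -/
theorem card_erase_le_nonEdges {V : Type*} [DecidableEq V] (G : SimpleGraph V)
    [DecidableRel G.Adj] (C : Finset V) (u : V) (p : V → V)
    (hp : ∀ w ∈ C.erase u, p w ∈ C ∧ w ≠ p w ∧ ¬ G.Adj w (p w))
    (hanti : ∀ w ∈ C.erase u, p w ∈ C.erase u → p (p w) ≠ w) :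
    (C.erase u).card ≤ nonEdges G C := by
  have hdisj : Disjoint ((C.erase u).image fun w => (w, p w))
      ((C.erase u).image fun w => (p w, w)) := by
    rw [Finset.disjoint_left]
    intro x hx hx'
    obtain ⟨a, ha, rfl⟩ := Finset.mem_image.1 hx
    obtain ⟨b, hb, hab⟩ := Finset.mem_image.1 hx'
    obtain ⟨rfl, h⟩ := Prod.mk.inj hab
    exact hanti b hb ha h.symm
  have hsub : ((C.erase u).image fun w => (w, p w)) ∪ ((C.erase u).image fun w => (p w, w)) ⊆
      (C ×ˢ C).filter (fun q => q.1 ≠ q.2 ∧ ¬ G.Adj q.1 q.2) := by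
    refine Finset.union_subset ?_ ?_ <;> refine Finset.image_subset_iff.2 fun w hw => ?_ <;>
      obtain ⟨h₁, h₂, h₃⟩ := hp w hw <;>
      simp [h₁, h₂, h₂.symm, h₃, Finset.mem_of_mem_erase hw, G.adj_comm (p w) w]
  have hcard := Finset.card_le_card hsub
  rw [Finset.card_union_of_disjoint hdisj,
    Finset.card_image_of_injective _ fun a b h => (Prod.mk.inj h).1,
    Finset.card_image_of_injective _ fun a b h => (Prod.mk.inj h).2] at hcard
  unfold nonEdges
  omega

/-- A `k`-defective clique of size at least `k + 2` has diameter at most two. -/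
theorem defective_clique_diameter_two {V : Type*} [DecidableEq V]
    (G : SimpleGraph V) [DecidableRel G.Adj] (k : ℕ) (C : Finset V)
    (hdef : nonEdges G C ≤ k) (hsize : k + 2 ≤ C.card)
    (u v : V) (hu : u ∈ C) (hv : v ∈ C) (huv : u ≠ v) (hadj : ¬ G.Adj u v) :
    ∃ w ∈ C, w ≠ u ∧ w ≠ v ∧ G.Adj w u ∧ G.Adj w v := by
  by_contra! hno
  have hle : (C.erase u).card ≤ nonEdges G C := by
    refine card_erase_le_nonEdges G C u (fun w => if G.Adj w u then v else u) ?_ ?_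
    · intro w hw
      have hwC := Finset.mem_of_mem_erase hw
      have hwu := Finset.ne_of_mem_erase hw
      by_cases h : G.Adj w u
      · have hwv : w ≠ v := fun e => hadj (e ▸ h).symm
        simp only [if_pos h]
        exact ⟨hv, hwv, hno w hwC hwu hwv h⟩
      · simp only [if_neg h]
        exact ⟨hu, hwu, h⟩
    · intro w hw hpw
      have hvu : ¬ G.Adj v u := fun h => hadj h.symm
      by_cases h : G.Adj w u
      · simpa [h, hvu] using (Finset.ne_of_mem_erase hw).symm
      · simp [h] at hpw
  rw [Finset.card_erase_of_mem hu] at hle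
  omega
end

section
/- Let G be a simple graph whose vertex set carries a linear order, k a natural number, and C a k-defective clique of G with |C| ≥ k+2. Let v be the minimum element of C with respect to the linear order. Then every u ∈ C satisfies one of: u = v; or u is adjacent to v; or there exists a vertex w with v ≤ w such that w is adjacent to v and w is adjacent to u. Consequently C is contained in {v} ∪ A ∪ (⋃_{a∈A} N(a)), where A is the set of neighbors a of v with v ≤ a. -/
open Finset

/-- If `u` and `v` are distinct non-adjacent vertices of `C` without a common neighbor in `C`, then
`C` induces at least `|C| - 1` non-edges. -/
theorem card_le_nonEdges_add_one {V : Type*} [DecidableEq V] (G : SimpleGraph V)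
    [DecidableRel G.Adj] {C : Finset V} {u v : V} (hu : u ∈ C) (hv : v ∈ C) (huv : u ≠ v)
    (hadj : ¬ G.Adj v u) (hcommon : ∀ w ∈ C, G.Adj v w → ¬ G.Adj w u) :
    C.card ≤ nonEdges G C + 1 := by
  let f : V → V × V := fun w => if G.Adj v w then (u, w) else (v, w)
  have f_snd : ∀ w, (f w).2 = w := fun w => by dsimp only [f]; split_ifs <;> rfl
  have f_fst : ∀ w, (f w).1 = u ∨ (f w).1 = v := fun w => by
    dsimp only [f]; split_ifs <;> simp
  have f_u : f u = (v, u) := if_neg hadj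
  have f_inj : Function.Injective f := fun a b h => by rw [← f_snd a, h, f_snd]
  have swap_inj : Function.Injective (fun w => (f w).swap) :=
    Prod.swap_injective.comp f_inj
  have f_mem : ∀ w ∈ C.erase v, (f w).1 ∈ C ∧ w ∈ C ∧ (f w).1 ≠ w ∧ ¬ G.Adj (f w).1 w := by
    intro w hw
    obtain ⟨hwv, hwC⟩ := Finset.mem_erase.mp hw
    by_cases h : G.Adj v w
    · have huw : u ≠ w := by rintro rfl; exact hadj h
      simpa [f, h, hu, hwC, huw] using fun h' => hcommon w hwC h h'.symm
    · simpa [f, h, hv, hwC] using hwv.symm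
  have hdisj : Disjoint ((C.erase v).image f) ((C.erase v).image fun w => (f w).swap) := by
    rw [Finset.disjoint_left]
    intro p hp hp'
    obtain ⟨a, ha, rfl⟩ := Finset.mem_image.mp hp
    obtain ⟨b, hb, hab⟩ := Finset.mem_image.mp hp'
    have hfst : b = (f a).1 := by rw [← hab, Prod.fst_swap, f_snd]
    have hsnd : (f b).1 = a := by rw [← f_snd a, ← hab, Prod.snd_swap]
    rcases f_fst a with h | h
    · obtain rfl : b = u := hfst.trans h
      rw [f_u] at hsnd
      exact Finset.ne_of_mem_erase ha hsnd.symm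
    · exact Finset.ne_of_mem_erase hb (hfst.trans h)
  have hsub : (C.erase v).image f ∪ (C.erase v).image (fun w => (f w).swap) ⊆
      (C ×ˢ C).filter (fun p => p.1 ≠ p.2 ∧ ¬ G.Adj p.1 p.2) := by
    intro p hp
    rw [Finset.mem_filter, Finset.mem_product]
    rcases Finset.mem_union.mp hp with hp | hp <;>
      obtain ⟨w, hw, rfl⟩ := Finset.mem_image.mp hp <;>
      obtain ⟨h₁, h₂, h₃, h₄⟩ := f_mem w hw
    · rw [f_snd]
      exact ⟨⟨h₁, h₂⟩, h₃, h₄⟩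
    · rw [Prod.fst_swap, Prod.snd_swap, f_snd]
      exact ⟨⟨h₂, h₁⟩, h₃.symm, fun h => h₄ h.symm⟩
  have hcard := Finset.card_le_card hsub
  rw [Finset.card_union_of_disjoint hdisj, Finset.card_image_of_injective _ f_inj,
    Finset.card_image_of_injective _ swap_inj, Finset.card_erase_of_mem hv] at hcard
  unfold nonEdges
  omega

/-- Let `C` be a `k`-defective clique with `|C| ≥ k + 2`, and let `v` be the minimum vertex of
`C` w.r.t. a linear order on the vertices. Then every `u ∈ C` either equals `v`, is adjacent
to `v`, or shares a common neighbor `w ≥ v` with `v`; consequently, `C` is contained in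
`{v} ∪ A ∪ ⋃_{a ∈ A} N(a)`, where `A = {a | G.Adj v a ∧ v ≤ a}`. -/
theorem defective_clique_within_two_hops {V : Type*} [DecidableEq V] [LinearOrder V]
    (G : SimpleGraph V) [DecidableRel G.Adj] (k : ℕ) (C : Finset V)
    (hdef : nonEdges G C ≤ k) (hsize : k + 2 ≤ C.card)
    (hne : C.Nonempty) (v : V) (hv : v = C.min' hne) :
    (∀ u ∈ C, u = v ∨ G.Adj v u ∨ ∃ w, v ≤ w ∧ G.Adj v w ∧ G.Adj w u) ∧
    (↑C : Set V) ⊆ {v} ∪ {a | G.Adj v a ∧ v ≤ a} ∪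
      ⋃ a ∈ {a | G.Adj v a ∧ v ≤ a}, G.neighborSet a := by
  have hvC : v ∈ C := hv ▸ C.min'_mem hne
  have hmin : ∀ w ∈ C, v ≤ w := fun w hw => hv ▸ C.min'_le w hw
  have hops : ∀ u ∈ C, u = v ∨ G.Adj v u ∨ ∃ w, v ≤ w ∧ G.Adj v w ∧ G.Adj w u := by
    intro u hu
    by_contra! h
    obtain ⟨huv, hadj, hcommon⟩ := h
    have := card_le_nonEdges_add_one G hu hvC huv hadj fun w hw => hcommon w (hmin w hw)
    omega
  refine ⟨hops, fun u hu => ?_⟩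
  rcases hops u hu with h | h | ⟨w, hvw, hw, hwu⟩
  · exact Or.inl (Or.inl h)
  · exact Or.inl (Or.inr ⟨h, hmin u hu⟩)
  · exact Or.inr (Set.mem_biUnion (show w ∈ {a | G.Adj v a ∧ v ≤ a} from ⟨hw, hvw⟩) hwu)
end

section
/- Let G be a simple graph that is α-degenerate, i.e., every finite nonempty set S of vertices contains a vertex v with at most α neighbors in S. Then every k-defective clique C of G satisfies |C| ≤ α + k + 1. -/
open Finset

/-- The non-neighbors of a vertex `v ∈ C` within `C`, other than `v`, are at most as many as the
non-edges induced by `C`. -/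
theorem card_nonneighbors_le_nonEdges {V : Type*} [DecidableEq V] (G : SimpleGraph V)
    [DecidableRel G.Adj] {C : Finset V} {v : V} (hv : v ∈ C) :
    (C.filter (fun w => v ≠ w ∧ ¬ G.Adj v w)).card ≤ nonEdges G C := by
  set N := C.filter (fun w => v ≠ w ∧ ¬ G.Adj v w) with hN
  have hdisj : Disjoint (({v} : Finset V) ×ˢ N) (N ×ˢ ({v} : Finset V)) := by
    rw [Finset.disjoint_left]
    rintro ⟨a, b⟩ h₁ h₂
    simp only [hN, mem_product, mem_singleton, mem_filter] at h₁ h₂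
    exact h₂.1.2.1 h₁.1.symm
  have hsub : ({v} : Finset V) ×ˢ N ∪ N ×ˢ ({v} : Finset V) ⊆
      (C ×ˢ C).filter (fun p => p.1 ≠ p.2 ∧ ¬ G.Adj p.1 p.2) := by
    rintro ⟨a, b⟩ h
    simp only [hN, mem_union, mem_product, mem_singleton, mem_filter] at h ⊢
    rcases h with ⟨rfl, hb, hne, hadj⟩ | ⟨⟨ha, hne, hadj⟩, rfl⟩
    · exact ⟨⟨hv, hb⟩, hne, hadj⟩
    · exact ⟨⟨ha, hv⟩, hne.symm, fun h => hadj h.symm⟩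
  have hcard := card_le_card hsub
  rw [card_union_of_disjoint hdisj, card_product, card_product, card_singleton] at hcard
  unfold nonEdges
  omega

/-- In an `α`-degenerate graph (every finite nonempty vertex set `S` contains a vertex with at
most `α` neighbors in `S`), every `k`-defective clique `C` satisfies `|C| ≤ α + k + 1`. -/
theorem defective_clique_degeneracy_bound {V : Type*} [DecidableEq V]
    (G : SimpleGraph V) [DecidableRel G.Adj] (α k : ℕ)
    (hdegen : ∀ S : Finset V, S.Nonempty → ∃ v ∈ S, (S.filter (fun w => G.Adj v w)).card ≤ α)
    (C : Finset V) (hdef : nonEdges G C ≤ k) :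
    C.card ≤ α + k + 1 := by
  rcases C.eq_empty_or_nonempty with rfl | hC
  · simp
  obtain ⟨v, hv, hdeg⟩ := hdegen C hC
  have hnon := card_nonneighbors_le_nonEdges G hv
  have hcover : C ⊆ C.filter (fun w => G.Adj v w) ∪
      C.filter (fun w => v ≠ w ∧ ¬ G.Adj v w) ∪ {v} := by
    intro w hw
    simp only [mem_union, mem_filter, mem_singleton]
    tauto
  have hcard := (card_le_card hcover).trans (card_union_le _ _)
  have hunion := card_union_le (C.filter (fun w => G.Adj v w))
    (C.filter (fun w => v ≠ w ∧ ¬ G.Adj v w))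
  rw [card_singleton] at hcard
  omega
end

section
/- Let G be a simple graph, k a natural number, V a finite set of vertices, and S ⊆ V. Let v_1, v_2, …, v_p be an enumeration of V \ S ordered so that the sequence of values |N̄_S(v_j)| (the number of non-neighbors of v_j in S) is non-decreasing. If C is a k-defective clique of G with S ⊆ C ⊆ V, then the number of non-edges induced by S plus the sum of |N̄_S(v_j)| over j = 1, …, |C \ S| is at most k. In particular, |C| ≤ |S| + i* where i* is the largest index i such that the number of non-edges induced by S plus ∑_{j=1}^{i} |N̄_S(v_j)| is at most k. -/
open Finset

/-- The number of non-neighbors of `u` lying in `S`. -/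
def nbar {V : Type*} [DecidableEq V] (G : SimpleGraph V) [DecidableRel G.Adj]
    (S : Finset V) (u : V) : ℕ :=
  (S.filter (fun w => w ≠ u ∧ ¬ G.Adj u w)).card

/-- Each vertex outside `S` contributes its non-neighbors in `S` to the non-edges of the union. -/
theorem nonEdges_add_sum_nbar_le {V : Type*} [DecidableEq V] (G : SimpleGraph V)
    [DecidableRel G.Adj] {S C : Finset V} (hSC : S ⊆ C) :
    nonEdges G S + ∑ u ∈ C \ S, nbar G S u ≤ nonEdges G C := by
  have card_eq : ∀ T : Finset V,
      ((T ×ˢ T).filter (fun p => p.1 ≠ p.2 ∧ ¬ G.Adj p.1 p.2)).card =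
        ∑ a ∈ T, ∑ b ∈ T, if a ≠ b ∧ ¬ G.Adj a b then 1 else 0 := by
    intro T
    rw [Finset.card_filter, Finset.sum_product]
  have outer : ∑ u ∈ C \ S, nbar G S u =
      ∑ a ∈ C \ S, ∑ b ∈ S, if a ≠ b ∧ ¬ G.Adj a b then 1 else 0 := by
    refine Finset.sum_congr rfl fun u _ => ?_
    rw [nbar, Finset.card_filter]
    simp only [ne_comm]
  have symm : ∑ a ∈ S, ∑ b ∈ C \ S, (if a ≠ b ∧ ¬ G.Adj a b then 1 else 0) =
      ∑ a ∈ C \ S, ∑ b ∈ S, if a ≠ b ∧ ¬ G.Adj a b then 1 else 0 := by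
    rw [Finset.sum_comm]
    simp only [ne_comm, G.adj_comm]
  have split : ∀ f : V → ℕ, ∑ a ∈ C, f a = ∑ a ∈ C \ S, f a + ∑ a ∈ S, f a :=
    fun f => (Finset.sum_sdiff hSC).symm
  have total : ∑ a ∈ C, ∑ b ∈ C, (if a ≠ b ∧ ¬ G.Adj a b then 1 else 0) =
      (∑ a ∈ C \ S, ∑ b ∈ C \ S, (if a ≠ b ∧ ¬ G.Adj a b then 1 else 0) +
        ∑ a ∈ C \ S, ∑ b ∈ S, (if a ≠ b ∧ ¬ G.Adj a b then 1 else 0)) +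
      (∑ a ∈ S, ∑ b ∈ C \ S, (if a ≠ b ∧ ¬ G.Adj a b then 1 else 0) +
        ∑ a ∈ S, ∑ b ∈ S, (if a ≠ b ∧ ¬ G.Adj a b then 1 else 0)) := by
    rw [split, ← Finset.sum_add_distrib, ← Finset.sum_add_distrib]
    simp only [← split]
  rw [nonEdges, nonEdges, card_eq, card_eq, outer]
  omega

/-- For a sequence that is non-decreasing below `p`, an initial segment has the smallest sum
among the index sets below `p` of the same size. -/
theorem sum_range_card_le_sum {g : ℕ → ℕ} {p : ℕ}
    (hg : ∀ i j, i ≤ j → j < p → g i ≤ g j) (A : Finset ℕ) (hA : ∀ j ∈ A, j < p) :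
    ∑ j ∈ Finset.range A.card, g j ≤ ∑ j ∈ A, g j := by
  induction A using Finset.induction_on_max with
  | empty => simp
  | insert a A ha ih =>
    have hcard : A.card ≤ a := by
      simpa using Finset.card_le_card (fun x hx => Finset.mem_range.2 (ha x hx))
    have hnot : a ∉ A := fun h => (ha a h).false
    rw [Finset.card_insert_of_notMem hnot, Finset.sum_range_succ, Finset.sum_insert hnot,
      add_comm]
    exact add_le_add (hg _ _ hcard (hA a (Finset.mem_insert_self a A)))
      (ih fun j hj => hA j (Finset.mem_insert_of_mem hj))

/-- Degree-sequence upper bound: enumerate `Vs \ S` as `v 0, v 1, …, v (p-1)` in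
non-decreasing order of the number `nbar` of non-neighbors in `S`.  If `C` is a `k`-defective
clique with `S ⊆ C ⊆ Vs`, then `nonEdges S + ∑_{j < |C \ S|} nbar (v j) ≤ k`; in particular
`|C| ≤ |S| + i*` for `i*` the largest index `i ≤ p` for which
`nonEdges S + ∑_{j < i} nbar (v j) ≤ k`. -/
theorem defective_clique_degree_sequence_bound {V : Type*} [DecidableEq V]
    (G : SimpleGraph V) [DecidableRel G.Adj] (k : ℕ) (Vs S : Finset V) (hSV : S ⊆ Vs)
    (p : ℕ) (hp : p = (Vs \ S).card) (v : ℕ → V)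
    (hmem : ∀ j < p, v j ∈ Vs \ S)
    (hinj : ∀ i < p, ∀ j < p, v i = v j → i = j)
    (hmono : ∀ i j, i ≤ j → j < p → nbar G S (v i) ≤ nbar G S (v j))
    (C : Finset V) (hdef : nonEdges G C ≤ k) (hSC : S ⊆ C) (hCV : C ⊆ Vs) :
    (nonEdges G S + ∑ j ∈ Finset.range ((C \ S).card), nbar G S (v j) ≤ k) ∧
    (∀ i : ℕ, i ≤ p →
      (nonEdges G S + ∑ j ∈ Finset.range i, nbar G S (v j) ≤ k) →
      (∀ i' : ℕ, i' ≤ p →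
        nonEdges G S + ∑ j ∈ Finset.range i', nbar G S (v j) ≤ k → i' ≤ i) →
      C.card ≤ S.card + i) := by
  have hinjOn : Set.InjOn v (Finset.range p) := fun i hi j hj h =>
    hinj i (by simpa using hi) j (by simpa using hj) h
  have himage : (Finset.range p).image v = Vs \ S := by
    refine Finset.eq_of_subset_of_card_le (fun x hx => ?_) ?_
    · obtain ⟨j, hj, rfl⟩ := Finset.mem_image.1 hx
      exact hmem j (Finset.mem_range.1 hj)
    · rw [Finset.card_image_of_injOn hinjOn, Finset.card_range, hp]
  have hsub : C \ S ⊆ Vs \ S := Finset.sdiff_subset_sdiff hCV le_rfl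
  obtain ⟨A, hAp, hAC⟩ := Finset.subset_image_iff.1 (himage ▸ hsub)
  have hAinj : Set.InjOn v A := hinjOn.mono hAp
  have hAcard : A.card = (C \ S).card := by
    rw [← hAC, Finset.card_image_of_injOn hAinj]
  have hmin : ∑ j ∈ Finset.range (C \ S).card, nbar G S (v j) ≤ ∑ u ∈ C \ S, nbar G S u := by
    have hsum : ∑ u ∈ C \ S, nbar G S u = ∑ j ∈ A, nbar G S (v j) := by
      rw [← hAC, Finset.sum_image hAinj]
    rw [← hAcard, hsum]
    exact sum_range_card_le_sum hmono A fun j hj => Finset.mem_range.1 (hAp hj)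
  have hbound : nonEdges G S + ∑ j ∈ Finset.range (C \ S).card, nbar G S (v j) ≤ k :=
    (Nat.add_le_add_left hmin _).trans ((nonEdges_add_sum_nbar_le G hSC).trans hdef)
  refine ⟨hbound, fun i _ _ hmax => ?_⟩
  have hle := hmax _ (hp ▸ Finset.card_le_card hsub) hbound
  have hcard := Finset.card_sdiff_add_card_eq_card hSC
  omega
end
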